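/- arXiv:2405.04714 — 5 statements merged into one kernel-verified Lean document; each statement's English description precedes it below -/
import Mathlib

section
/- Let α ∈ [0,1) and let μ be a probability measure on ℝ such that the identity function is integrable with respect to μ. Let a ∈ ℝ with μ({a}) = 0. Then the function f(x) := x + (1−α)⁻¹ · ∫ max(0, z − x) ∂μ(z) is differentiable at a with derivative f′(a) = 1 − (1−α)⁻¹ · μ([a, ∞)). -/
open MeasureTheory Set Filter

theorem hasDerivAt_max_zero_sub {z a : ℝ} (h : z ≠ a) :
    HasDerivAt (fun x : ℝ => max 0 (z - x)) ((Ici a).indicator (fun _ => (-1 : ℝ)) z) a := by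
  rcases lt_or_gt_of_ne h with h | h
  · rw [indicator_of_notMem (by simpa using h)]
    refine (hasDerivAt_const a (0 : ℝ)).congr_of_eventuallyEq ?_
    filter_upwards [lt_mem_nhds h] with x hx
    exact max_eq_left (by linarith)
  · rw [indicator_of_mem (by simpa using h.le)]
    refine ((hasDerivAt_id a).const_sub z).congr_of_eventuallyEq ?_
    filter_upwards [gt_mem_nhds h] with x hx
    exact max_eq_right (by simpa using hx.le)

theorem lipschitzWith_max_zero_sub (z : ℝ) :
    LipschitzWith 1 (fun x : ℝ => max 0 (z - x)) := by
  refine LipschitzWith.const_max (LipschitzWith.of_dist_le_mul fun x y => ?_) 0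
  rw [dist_sub_left, NNReal.coe_one, one_mul]

theorem hasDerivAt_integral_max_zero_sub (μ : Measure ℝ) [IsFiniteMeasure μ]
    (hint : Integrable (fun z : ℝ => z) μ) (a : ℝ) (ha : μ {a} = 0) :
    HasDerivAt (fun x : ℝ => ∫ z, max 0 (z - x) ∂μ) (-(μ (Ici a)).toReal) a := by
  have hderiv := (hasDerivAt_integral_of_dominated_loc_of_lip (μ := μ) (x₀ := a)
    (F := fun x z : ℝ => max 0 (z - x)) (F' := (Ici a).indicator fun _ => (-1 : ℝ))
    (bound := fun _ => 1) (s := univ) univ_mem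
    (.of_forall fun x => (by fun_prop : Continuous fun z : ℝ => max 0 (z - x)).aestronglyMeasurable)
    ((integrable_zero ℝ ℝ μ).sup (hint.sub (integrable_const a)))
    ((measurable_const.indicator measurableSet_Ici).aestronglyMeasurable)
    (.of_forall fun z => by simpa using lipschitzWith_max_zero_sub z)
    (integrable_const 1)
    (by
      filter_upwards [compl_mem_ae_iff.mpr ha] with z hz
      exact hasDerivAt_max_zero_sub hz)).2
  simpa [integral_indicator_const _ measurableSet_Ici, Measure.real] using hderiv

theorem hasDerivAt_cvar_objective (α : ℝ) (hα : α ∈ Set.Ico (0 : ℝ) 1)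
    (μ : Measure ℝ) [IsProbabilityMeasure μ]
    (hint : Integrable (fun z : ℝ => z) μ) (a : ℝ) (ha : μ {a} = 0) :
    HasDerivAt (fun x : ℝ => x + (1 - α)⁻¹ * ∫ z, max 0 (z - x) ∂μ)
      (1 - (1 - α)⁻¹ * (μ (Ici a)).toReal) a := by
  rw [sub_eq_add_neg 1 (_ * _), ← mul_neg]
  exact (hasDerivAt_id' a).add
    ((hasDerivAt_integral_max_zero_sub μ hint a ha).const_mul (1 - α)⁻¹)
end

section
/- Let α ∈ [0,1) and let μ be a probability measure on ℝ such that the identity function is integrable with respect to μ. Define f(x) := x + (1−α)⁻¹ · ∫ max(0, z − x) ∂μ(z). Suppose a* ∈ ℝ satisfies μ({a*}) = 0 and μ([a*, ∞)) = 1 − α. Then (i) f(a*) ≤ f(a) for every a ∈ ℝ, and (ii) f(a*) = (1−α)⁻¹ · ∫_{[a*,∞)} z ∂μ(z), i.e. the minimum value of f equals the conditional expectation of μ on the upper tail {z ≥ a*}. -/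
open MeasureTheory Set Filter

theorem integrable_max_zero_sub {μ : Measure ℝ} [IsFiniteMeasure μ]
    (hint : Integrable (fun z : ℝ => z) μ) (a : ℝ) :
    Integrable (fun z : ℝ => max 0 (z - a)) μ :=
  (integrable_zero ℝ ℝ μ).sup (hint.sub (integrable_const a))

theorem setIntegral_sub_const_eq {μ : Measure ℝ} [IsFiniteMeasure μ]
    (hint : Integrable (fun z : ℝ => z) μ) (s : Set ℝ) (a : ℝ) :
    ∫ z in s, (z - a) ∂μ = ∫ z in s, z ∂μ - μ.real s * a := by
  rw [integral_sub hint.integrableOn (integrable_const a), setIntegral_const, smul_eq_mul]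

theorem setIntegral_sub_const_le_integral_max {μ : Measure ℝ} [IsFiniteMeasure μ]
    (hint : Integrable (fun z : ℝ => z) μ) (s : Set ℝ) (a : ℝ) :
    ∫ z in s, (z - a) ∂μ ≤ ∫ z, max 0 (z - a) ∂μ :=
  (integral_mono (hint.integrableOn.sub (integrable_const a))
    (integrable_max_zero_sub hint a).integrableOn fun _ => le_max_right _ _).trans
    (setIntegral_le_integral (integrable_max_zero_sub hint a)
      (ae_of_all _ fun _ => le_max_left _ _))

theorem integral_max_zero_sub_eq_setIntegral_Ici (μ : Measure ℝ) (a : ℝ) :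
    ∫ z, max 0 (z - a) ∂μ = ∫ z in Ici a, (z - a) ∂μ := by
  rw [← integral_indicator measurableSet_Ici]
  congr 1 with z
  by_cases hz : a ≤ z
  · simp [hz]
  · simp [hz, (not_le.mp hz).le]

theorem cvar_objective_min (α : ℝ) (hα : α ∈ Set.Ico (0 : ℝ) 1)
    (μ : Measure ℝ) [IsProbabilityMeasure μ]
    (hint : Integrable (fun z : ℝ => z) μ) (astar : ℝ)
    (h0 : μ {astar} = 0) (htail : μ (Ici astar) = ENNReal.ofReal (1 - α)) :
    (∀ a : ℝ, astar + (1 - α)⁻¹ * ∫ z, max 0 (z - astar) ∂μ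
        ≤ a + (1 - α)⁻¹ * ∫ z, max 0 (z - a) ∂μ) ∧
      astar + (1 - α)⁻¹ * ∫ z, max 0 (z - astar) ∂μ
        = (1 - α)⁻¹ * ∫ z in Ici astar, z ∂μ := by
  have hpos : 0 < 1 - α := sub_pos.mpr hα.2
  have hreal : μ.real (Ici astar) = 1 - α := by
    rw [measureReal_def, htail, ENNReal.toReal_ofReal hpos.le]
  have htail_eq (a : ℝ) : a + (1 - α)⁻¹ * ∫ z in Ici astar, (z - a) ∂μ
      = (1 - α)⁻¹ * ∫ z in Ici astar, z ∂μ := by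
    rw [setIntegral_sub_const_eq hint, hreal, mul_sub, inv_mul_cancel_left₀ hpos.ne']
    ring
  have hmin : astar + (1 - α)⁻¹ * ∫ z, max 0 (z - astar) ∂μ
      = (1 - α)⁻¹ * ∫ z in Ici astar, z ∂μ := by
    rw [integral_max_zero_sub_eq_setIntegral_Ici, htail_eq]
  refine ⟨fun a => ?_, hmin⟩
  rw [hmin, ← htail_eq a]
  gcongr
  exact setIntegral_sub_const_le_integral_max hint _ a
end

section
/- Let μ and ν be probability measures on ℝ such that the identity function is integrable with respect to both, and let F_μ, F_ν denote their cumulative distribution functions F_μ(t) = μ((−∞, t]), F_ν(t) = ν((−∞, t]). Then ∫ z ∂ν(z) − ∫ z ∂μ(z) = ∫_ℝ (F_μ(t) − F_ν(t)) dt, where in particular the function t ↦ F_μ(t) − F_ν(t) is integrable on ℝ. -/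
open MeasureTheory Set Filter

/-- The difference of the indicators of `[z, ∞)` and `[0, ∞)` is supported between `0` and `z`. -/
lemma indicator_Ici_sub_indicator_Ici_zero (z t : ℝ) :
    (Ici z).indicator (1 : ℝ → ℝ) t - (Ici 0).indicator (1 : ℝ → ℝ) t =
      (Ico z 0).indicator (1 : ℝ → ℝ) t - (Ico 0 z).indicator (1 : ℝ → ℝ) t := by
  simp only [indicator_apply, mem_Ici, mem_Ico, Pi.one_apply]
  grind

lemma abs_indicator_Ici_sub_indicator_Ici_zero (z t : ℝ) :
    |(Ici z).indicator (1 : ℝ → ℝ) t - (Ici 0).indicator (1 : ℝ → ℝ) t| =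
      (Ico z 0).indicator (1 : ℝ → ℝ) t + (Ico 0 z).indicator (1 : ℝ → ℝ) t := by
  simp only [indicator_apply, mem_Ici, mem_Ico, Pi.one_apply]
  grind

lemma integrable_indicator_Ico_one (a b : ℝ) :
    Integrable ((Ico a b).indicator (1 : ℝ → ℝ)) :=
  (integrable_indicator_iff measurableSet_Ico).2 (integrableOn_const (by simp))

lemma integral_indicator_Ico_one (a b : ℝ) :
    ∫ t, (Ico a b).indicator (1 : ℝ → ℝ) t = max (b - a) 0 := by
  rw [integral_indicator_one measurableSet_Ico, Real.volume_real_Ico]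

lemma integrable_prod_indicator_Ici_sub {μ : Measure ℝ} [IsProbabilityMeasure μ]
    (hμ : Integrable (fun z : ℝ => z) μ) :
    Integrable (Function.uncurry fun z t : ℝ =>
      (Ici z).indicator (1 : ℝ → ℝ) t - (Ici 0).indicator (1 : ℝ → ℝ) t) (μ.prod volume) := by
  have hmeas : Measurable (Function.uncurry fun z t : ℝ =>
      (Ici z).indicator (1 : ℝ → ℝ) t - (Ici 0).indicator (1 : ℝ → ℝ) t) := by
    refine Measurable.sub ?_ ?_
    · exact Measurable.ite (measurableSet_le measurable_fst measurable_snd)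
        measurable_const measurable_const
    · exact (measurable_one.indicator measurableSet_Ici).comp measurable_snd
  rw [integrable_prod_iff hmeas.aestronglyMeasurable]
  constructor
  · refine ae_of_all _ fun z => ?_
    simp only [Function.uncurry_apply_pair, indicator_Ici_sub_indicator_Ici_zero]
    exact (integrable_indicator_Ico_one z 0).sub (integrable_indicator_Ico_one 0 z)
  · refine hμ.abs.congr (ae_of_all _ fun z => ?_)
    simp only [Function.uncurry_apply_pair, Real.norm_eq_abs,
      abs_indicator_Ici_sub_indicator_Ici_zero]
    rw [integral_add (integrable_indicator_Ico_one z 0) (integrable_indicator_Ico_one 0 z),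
      integral_indicator_Ico_one, integral_indicator_Ico_one]
    grind

lemma integral_indicator_Ici_sub_measure (μ : Measure ℝ) [IsProbabilityMeasure μ] (t : ℝ) :
    ∫ z, ((Ici z).indicator (1 : ℝ → ℝ) t - (Ici 0).indicator (1 : ℝ → ℝ) t) ∂μ =
      (μ (Iic t)).toReal - (Ici 0).indicator (1 : ℝ → ℝ) t := by
  have h : (fun z : ℝ => (Ici z).indicator (1 : ℝ → ℝ) t) = (Iic t).indicator 1 := by
    ext z
    simp [indicator_apply]
  have hint : Integrable (fun z : ℝ => (Ici z).indicator (1 : ℝ → ℝ) t) μ := by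
    rw [h]
    exact (integrable_const (1 : ℝ)).indicator measurableSet_Iic
  rw [integral_sub hint (integrable_const _), h, integral_indicator_one measurableSet_Iic]
  simp [measureReal_def]

lemma integral_indicator_Ici_sub_volume (z : ℝ) :
    ∫ t, ((Ici z).indicator (1 : ℝ → ℝ) t - (Ici 0).indicator (1 : ℝ → ℝ) t) = -z := by
  simp only [indicator_Ici_sub_indicator_Ici_zero]
  rw [integral_sub (integrable_indicator_Ico_one z 0) (integrable_indicator_Ico_one 0 z),
    integral_indicator_Ico_one, integral_indicator_Ico_one]
  grind

/-- The distribution function minus that of the Dirac mass at `0` is integrable. -/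
lemma integrable_measure_Iic_sub_indicator {μ : Measure ℝ} [IsProbabilityMeasure μ]
    (hμ : Integrable (fun z : ℝ => z) μ) :
    Integrable (fun t : ℝ => (μ (Iic t)).toReal - (Ici 0).indicator (1 : ℝ → ℝ) t) := by
  simpa only [Function.uncurry_apply_pair, integral_indicator_Ici_sub_measure] using
    (integrable_prod_indicator_Ici_sub hμ).integral_prod_right

lemma integral_measure_Iic_sub_indicator {μ : Measure ℝ} [IsProbabilityMeasure μ]
    (hμ : Integrable (fun z : ℝ => z) μ) :
    ∫ t : ℝ, ((μ (Iic t)).toReal - (Ici 0).indicator (1 : ℝ → ℝ) t) = -∫ z, z ∂μ := by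
  have h := integral_integral_swap (integrable_prod_indicator_Ici_sub hμ)
  simp only [integral_indicator_Ici_sub_measure, integral_indicator_Ici_sub_volume] at h
  rw [← h, integral_neg]

theorem mean_diff_eq_integral_cdf_diff (μ ν : Measure ℝ)
    [IsProbabilityMeasure μ] [IsProbabilityMeasure ν]
    (hμ : Integrable (fun z : ℝ => z) μ) (hν : Integrable (fun z : ℝ => z) ν) :
    Integrable (fun t : ℝ => (μ (Iic t)).toReal - (ν (Iic t)).toReal) ∧
      (∫ z, z ∂ν) - ∫ z, z ∂μ = ∫ t : ℝ, ((μ (Iic t)).toReal - (ν (Iic t)).toReal) := by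
  have iμ := integrable_measure_Iic_sub_indicator hμ
  have iν := integrable_measure_Iic_sub_indicator hν
  have hsub := integral_sub iμ iν
  have hint := iμ.sub' iν
  simp only [sub_sub_sub_cancel_right] at hint hsub
  refine ⟨hint, ?_⟩
  rw [hsub, integral_measure_Iic_sub_indicator hμ, integral_measure_Iic_sub_indicator hν]
  ring
end

section
/- Let μ and ν be probability measures on ℝ such that the identity function is integrable with respect to both, with cumulative distribution functions F_μ and F_ν. Then the difference of means is bounded by the earth mover's distance: |∫ z ∂μ(z) − ∫ z ∂ν(z)| ≤ ∫_ℝ |F_μ(t) − F_ν(t)| dt. -/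
open MeasureTheory Set Filter

/-- The difference of the distribution functions of the Dirac masses at `0` and at `z`. -/
noncomputable def heavisideDiff (z t : ℝ) : ℝ :=
  (Ici 0).indicator 1 t - (Ici z).indicator 1 t

lemma heavisideDiff_of_nonneg {z : ℝ} (hz : 0 ≤ z) :
    heavisideDiff z = (Ico 0 z).indicator 1 := by
  ext t
  simp only [heavisideDiff, indicator_apply, mem_Ici, mem_Ico, Pi.one_apply]
  grind

lemma heavisideDiff_of_nonpos {z : ℝ} (hz : z ≤ 0) :
    heavisideDiff z = -(Ico z 0).indicator 1 := by
  ext t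
  simp only [heavisideDiff, indicator_apply, mem_Ici, mem_Ico, Pi.one_apply, Pi.neg_apply]
  grind

lemma integrable_heavisideDiff (z : ℝ) : Integrable (heavisideDiff z) := by
  rcases le_total 0 z with hz | hz
  · rw [heavisideDiff_of_nonneg hz]
    exact integrable_indicator_Ico_one 0 z
  · rw [heavisideDiff_of_nonpos hz]
    exact (integrable_indicator_Ico_one z 0).neg

lemma integral_heavisideDiff (z : ℝ) : ∫ t, heavisideDiff z t = z := by
  rcases le_total 0 z with hz | hz
  · simp [heavisideDiff_of_nonneg hz, integral_indicator_one, hz]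
  · simp [heavisideDiff_of_nonpos hz, integral_neg, integral_indicator_one, hz]

lemma integral_norm_heavisideDiff (z : ℝ) : ∫ t, ‖heavisideDiff z t‖ = |z| := by
  rcases le_total 0 z with hz | hz
  · simp [heavisideDiff_of_nonneg hz, norm_indicator_eq_indicator_norm, abs_of_nonneg hz,
      ← Pi.one_def, integral_indicator_one, hz]
  · simp [heavisideDiff_of_nonpos hz, norm_indicator_eq_indicator_norm, abs_of_nonpos hz,
      ← Pi.one_def, integral_indicator_one, hz]

lemma measurable_uncurry_heavisideDiff :
    Measurable (Function.uncurry heavisideDiff) := by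
  have h : Function.uncurry heavisideDiff = fun p : ℝ × ℝ ↦
      (if 0 ≤ p.2 then (1 : ℝ) else 0) - if p.1 ≤ p.2 then (1 : ℝ) else 0 := by
    ext p
    simp [Function.uncurry, heavisideDiff, indicator_apply]
  rw [h]
  exact (Measurable.ite (measurableSet_le measurable_const measurable_snd)
    measurable_const measurable_const).sub
    (Measurable.ite (measurableSet_le measurable_fst measurable_snd)
      measurable_const measurable_const)

lemma integral_heavisideDiff_left (μ : Measure ℝ) [IsProbabilityMeasure μ] (t : ℝ) :
    ∫ z, heavisideDiff z t ∂μ = (Ici 0).indicator 1 t - (μ (Iic t)).toReal := by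
  have h : (fun z ↦ (Ici z).indicator (1 : ℝ → ℝ) t) = (Iic t).indicator 1 := by
    ext z
    simp [indicator_apply]
  have hi : Integrable (fun z ↦ (Ici z).indicator (1 : ℝ → ℝ) t) μ := by
    rw [h]
    exact (integrable_const (1 : ℝ)).indicator measurableSet_Iic
  simp only [heavisideDiff]
  rw [integral_sub (integrable_const _) hi, h, integral_indicator_one measurableSet_Iic]
  simp [measureReal_def]

lemma integrable_uncurry_heavisideDiff (μ : Measure ℝ) [IsProbabilityMeasure μ]
    (hμ : Integrable (fun z : ℝ ↦ z) μ) :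
    Integrable (Function.uncurry heavisideDiff) (μ.prod volume) := by
  rw [integrable_prod_iff measurable_uncurry_heavisideDiff.aestronglyMeasurable]
  refine ⟨.of_forall integrable_heavisideDiff, ?_⟩
  simpa only [Function.uncurry_apply_pair, integral_norm_heavisideDiff] using hμ.abs

lemma integrable_indicator_sub_cdf (μ : Measure ℝ) [IsProbabilityMeasure μ]
    (hμ : Integrable (fun z : ℝ ↦ z) μ) :
    Integrable (fun t : ℝ ↦ (Ici 0).indicator 1 t - (μ (Iic t)).toReal) := by
  simpa only [Function.uncurry_apply_pair, integral_heavisideDiff_left] using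
    (integrable_uncurry_heavisideDiff μ hμ).integral_prod_right

lemma integral_indicator_sub_cdf (μ : Measure ℝ) [IsProbabilityMeasure μ]
    (hμ : Integrable (fun z : ℝ ↦ z) μ) :
    ∫ t : ℝ, ((Ici 0).indicator 1 t - (μ (Iic t)).toReal) = ∫ z, z ∂μ := by
  simpa only [integral_heavisideDiff, integral_heavisideDiff_left] using
    (integral_integral_swap (integrable_uncurry_heavisideDiff μ hμ)).symm

theorem abs_mean_diff_le_emd (μ ν : Measure ℝ)
    [IsProbabilityMeasure μ] [IsProbabilityMeasure ν]
    (hμ : Integrable (fun z : ℝ => z) μ) (hν : Integrable (fun z : ℝ => z) ν) :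
    |(∫ z, z ∂μ) - ∫ z, z ∂ν| ≤ ∫ t : ℝ, |(μ (Iic t)).toReal - (ν (Iic t)).toReal| := by
  rw [← integral_indicator_sub_cdf μ hμ, ← integral_indicator_sub_cdf ν hν,
    ← integral_sub (integrable_indicator_sub_cdf μ hμ) (integrable_indicator_sub_cdf ν hν)]
  refine abs_integral_le_integral_abs.trans_eq (integral_congr_ae (.of_forall fun t ↦ ?_))
  simp only [sub_sub_sub_cancel_left]
  exact abs_sub_comm _ _
end

section
/- Fix D > 0 and α = 1/2. Let μ₁ := (1/2)·δ_D + (1/2)·δ_{D/2}, μ₂ := (1/2)·δ_D + (1/2)·δ_{−D/2}, and μ̂ := (1/2)•μ₁ + (1/2)•μ₂, where δ_x is the Dirac measure at x. Then the ensemble CVaR gap vanishes, (1/2)·(CVaR_{1/2}(μ₁) + CVaR_{1/2}(μ₂)) − CVaR_{1/2}(μ̂) = 0, while the average tail earth mover's distance is strictly positive: (1/2)·(∫_ℝ |G_{1/2,μ̂}(t) − G_{1/2,μ₁}(t)| dt + ∫_ℝ |G_{1/2,μ̂}(t) − G_{1/2,μ₂}(t)| dt) = D/2. -/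
open scoped ENNReal
open MeasureTheory ProbabilityTheory Set Filter

/-- Lower-tail conditional value at risk at level `α` of a real measure `μ`:
`CVaR_α(μ) = ⨆ a, (a - (1-α)⁻¹ * ∫ max 0 (a - z) ∂μ)`. -/
noncomputable def cvar (α : ℝ) (μ : Measure ℝ) : ℝ :=
  ⨆ a : ℝ, (a - (1 - α)⁻¹ * ∫ z, max 0 (a - z) ∂μ)

/-- Clipped tail CDF `G_{α,μ}(z) = min (F_μ z) (1 - α) / (1 - α)`. -/
noncomputable def tailCDFfun (α : ℝ) (μ : Measure ℝ) : ℝ → ℝ :=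
  fun z => min ((μ (Iic z)).toReal) (1 - α) / (1 - α)

theorem integrable_half_add_half {μ ν : Measure ℝ} {f : ℝ → ℝ} (hμ : Integrable f μ)
    (hν : Integrable f ν) : Integrable f ((2 : ℝ≥0∞)⁻¹ • μ + (2 : ℝ≥0∞)⁻¹ • ν) :=
  (hμ.smul_measure (by simp)).add_measure (hν.smul_measure (by simp))

theorem integral_half_add_half {μ ν : Measure ℝ} {f : ℝ → ℝ} (hμ : Integrable f μ)
    (hν : Integrable f ν) :
    ∫ z, f z ∂((2 : ℝ≥0∞)⁻¹ • μ + (2 : ℝ≥0∞)⁻¹ • ν) = (∫ z, f z ∂μ + ∫ z, f z ∂ν) / 2 := by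
  rw [integral_add_measure (hμ.smul_measure (by simp)) (hν.smul_measure (by simp)),
    integral_smul_measure, integral_smul_measure]
  simp
  ring

theorem integrable_dirac_real (f : ℝ → ℝ) (x : ℝ) : Integrable f (Measure.dirac x) :=
  integrable_dirac (by simp)

theorem cvar_eq_of_le_of_eq {α c a₀ : ℝ} {μ : Measure ℝ}
    (hle : ∀ a : ℝ, a - (1 - α)⁻¹ * ∫ z, max 0 (a - z) ∂μ ≤ c)
    (heq : a₀ - (1 - α)⁻¹ * ∫ z, max 0 (a₀ - z) ∂μ = c) : cvar α μ = c :=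
  IsGreatest.csSup_eq ⟨⟨a₀, heq⟩, by rintro _ ⟨a, rfl⟩; exact hle a⟩

theorem toReal_half_add_half_apply (μ ν : Measure ℝ) [IsFiniteMeasure μ] [IsFiniteMeasure ν]
    (s : Set ℝ) :
    (((2 : ℝ≥0∞)⁻¹ • μ + (2 : ℝ≥0∞)⁻¹ • ν) s).toReal = ((μ s).toReal + (ν s).toReal) / 2 := by
  rw [Measure.add_apply, Measure.smul_apply, Measure.smul_apply, smul_eq_mul, smul_eq_mul,
    ENNReal.toReal_add (ENNReal.mul_ne_top (by simp) (measure_ne_top _ _))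
      (ENNReal.mul_ne_top (by simp) (measure_ne_top _ _))]
  simp
  ring

theorem toReal_dirac_Iic (x t : ℝ) :
    (Measure.dirac x (Iic t)).toReal = if x ≤ t then 1 else 0 := by
  by_cases h : x ≤ t <;> simp [h]

theorem isFiniteMeasure_half_add_half (μ ν : Measure ℝ) [IsFiniteMeasure μ] [IsFiniteMeasure ν] :
    IsFiniteMeasure ((2 : ℝ≥0∞)⁻¹ • μ + (2 : ℝ≥0∞)⁻¹ • ν) :=
  have := Measure.smul_finite μ (c := (2 : ℝ≥0∞)⁻¹) (by simp)
  have := Measure.smul_finite ν (c := (2 : ℝ≥0∞)⁻¹) (by simp)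
  inferInstance

theorem integral_half_indicator_Ico {D : ℝ} (hD : 0 < D) :
    ∫ t, (Ico (-(D / 2)) (D / 2)).indicator (fun _ => (1 / 2 : ℝ)) t = D / 2 := by
  rw [integral_indicator measurableSet_Ico, setIntegral_const, Real.volume_real_Ico_of_le
    (by linarith), smul_eq_mul]
  ring

theorem cvar_gap_zero_tail_emd_pos (D : ℝ) (hD : 0 < D) :
    let μ₁ : Measure ℝ := (2 : ℝ≥0∞)⁻¹ • Measure.dirac D + (2 : ℝ≥0∞)⁻¹ • Measure.dirac (D / 2)
    let μ₂ : Measure ℝ := (2 : ℝ≥0∞)⁻¹ • Measure.dirac D + (2 : ℝ≥0∞)⁻¹ • Measure.dirac (-(D / 2))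
    let μhat : Measure ℝ := (2 : ℝ≥0∞)⁻¹ • μ₁ + (2 : ℝ≥0∞)⁻¹ • μ₂
    (1 / 2 : ℝ) * (cvar (1 / 2) μ₁ + cvar (1 / 2) μ₂) - cvar (1 / 2) μhat = 0 ∧
      (1 / 2 : ℝ) * ((∫ t : ℝ, |tailCDFfun (1 / 2) μhat t - tailCDFfun (1 / 2) μ₁ t|) +
          ∫ t : ℝ, |tailCDFfun (1 / 2) μhat t - tailCDFfun (1 / 2) μ₂ t|) = D / 2 := by
  intro μ₁ μ₂ μhat
  have i₁ (f : ℝ → ℝ) : ∫ z, f z ∂μ₁ = (f D + f (D / 2)) / 2 := by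
    rw [integral_half_add_half (integrable_dirac_real _ _) (integrable_dirac_real _ _),
      integral_dirac, integral_dirac]
  have i₂ (f : ℝ → ℝ) : ∫ z, f z ∂μ₂ = (f D + f (-(D / 2))) / 2 := by
    rw [integral_half_add_half (integrable_dirac_real _ _) (integrable_dirac_real _ _),
      integral_dirac, integral_dirac]
  have ihat (f : ℝ → ℝ) :
      ∫ z, f z ∂μhat = ((f D + f (D / 2)) / 2 + (f D + f (-(D / 2))) / 2) / 2 := by
    rw [integral_half_add_half
      (integrable_half_add_half (integrable_dirac_real _ _) (integrable_dirac_real _ _))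
      (integrable_half_add_half (integrable_dirac_real _ _) (integrable_dirac_real _ _)), i₁, i₂]
  have c₁ : cvar (1 / 2) μ₁ = D / 2 := by
    refine cvar_eq_of_le_of_eq (a₀ := D / 2) (fun a => ?_) ?_ <;> rw [i₁] <;> norm_num <;> grind
  have c₂ : cvar (1 / 2) μ₂ = -(D / 2) := by
    refine cvar_eq_of_le_of_eq (a₀ := -(D / 2)) (fun a => ?_) ?_ <;> rw [i₂] <;> norm_num <;> grind
  have chat : cvar (1 / 2) μhat = 0 := by
    refine cvar_eq_of_le_of_eq (a₀ := D / 2) (fun a => ?_) ?_ <;> rw [ihat] <;> norm_num <;> grind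
  have : IsFiniteMeasure μ₁ := isFiniteMeasure_half_add_half _ _
  have : IsFiniteMeasure μ₂ := isFiniteMeasure_half_add_half _ _
  have F₁ (t : ℝ) : (μ₁ (Iic t)).toReal
      = ((if D ≤ t then 1 else 0) + if D / 2 ≤ t then 1 else 0) / 2 := by
    rw [toReal_half_add_half_apply, toReal_dirac_Iic, toReal_dirac_Iic]
  have F₂ (t : ℝ) : (μ₂ (Iic t)).toReal
      = ((if D ≤ t then 1 else 0) + if -(D / 2) ≤ t then 1 else 0) / 2 := by
    rw [toReal_half_add_half_apply, toReal_dirac_Iic, toReal_dirac_Iic]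
  have Fhat (t : ℝ) : (μhat (Iic t)).toReal
      = ((μ₁ (Iic t)).toReal + (μ₂ (Iic t)).toReal) / 2 := toReal_half_add_half_apply _ _ _
  have d₁ (t : ℝ) : |tailCDFfun (1 / 2) μhat t - tailCDFfun (1 / 2) μ₁ t|
      = (Ico (-(D / 2)) (D / 2)).indicator (fun _ => (1 / 2 : ℝ)) t := by
    simp only [tailCDFfun, Fhat, F₁, F₂, indicator_apply, mem_Ico]
    grind
  have d₂ (t : ℝ) : |tailCDFfun (1 / 2) μhat t - tailCDFfun (1 / 2) μ₂ t|
      = (Ico (-(D / 2)) (D / 2)).indicator (fun _ => (1 / 2 : ℝ)) t := by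
    simp only [tailCDFfun, Fhat, F₁, F₂, indicator_apply, mem_Ico]
    grind
  constructor
  · rw [c₁, c₂, chat]
    ring
  · simp only [d₁, d₂, integral_half_indicator_Ico hD]
    ring
end
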